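/- arXiv:1605.05750 — 2 statements merged into one kernel-verified Lean document; each statement's English description precedes it below -/
import Mathlib

section
/- A lattice function f : ℤ_{≥0} → ℝ belongs to 𝒰* if and only if there exists g ∈ ℓ²(ℤ_{≥0}) such that Σ_{ℓ=0}^∞ f_ℓ u_ℓ = Σ_{ℓ=0}^∞ g_ℓ u'_ℓ for all compactly supported u ∈ 𝒰. In that case g is unique and given by g_ℓ = Σ_{k=ℓ+1}^∞ f_k (a convergent sum), and the optimal dual norm satisfies ‖f‖_{𝒰*} = ‖g‖_{ℓ²}. -/
open scoped BigOperators ENNReal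
open Filter MeasureTheory

noncomputable section

/-- discrete strain: `u'_ℓ = u_{ℓ+1} - u_ℓ` -/
def du (u : ℕ → ℝ) (ℓ : ℕ) : ℝ := u (ℓ + 1) - u ℓ

/-- second difference of strains: `u''_ℓ = u'_{ℓ+1} - u'_ℓ` -/
def ddu (u : ℕ → ℝ) (ℓ : ℕ) : ℝ := du u (ℓ + 1) - du u ℓ

/-- the displacement space 𝒰 -/
def memU (u : ℕ → ℝ) : Prop := u 0 = 0 ∧ Summable (fun ℓ => (du u ℓ) ^ 2)

/-- ℓ² norm of a sequence -/
def l2 (e : ℕ → ℝ) : ℝ := Real.sqrt (∑' ℓ, (e ℓ) ^ 2)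

/-- compactly supported lattice function -/
def FinSupp (u : ℕ → ℝ) : Prop := ∃ N : ℕ, ∀ ℓ : ℕ, N ≤ ℓ → u ℓ = 0

/-- membership in the dual space 𝒰* -/
def memUstar (f : ℕ → ℝ) : Prop :=
  ∃ M : ℝ, ∀ u : ℕ → ℝ, u 0 = 0 → FinSupp u → |∑' ℓ, f ℓ * u ℓ| ≤ M * l2 (du u)

/-- the dual norm ‖f‖_{𝒰*} -/
def dualNorm (f : ℕ → ℝ) : ℝ :=
  sInf {M : ℝ | 0 ≤ M ∧ ∀ u : ℕ → ℝ, u 0 = 0 → FinSupp u →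
    |∑' ℓ, f ℓ * u ℓ| ≤ M * l2 (du u)}

/-- `g_ℓ = Σ_{k=ℓ+1}^∞ f_k`, as a limit of partial sums -/
def gOf (f : ℕ → ℝ) (ℓ : ℕ) : ℝ :=
  limUnder atTop (fun K : ℕ => ∑ k ∈ Finset.Ico (ℓ + 1) K, f k)

/-- duality pairing `⟨f, v⟩` for `v ∈ 𝒰`, extended by continuity (summation by parts) -/
def pairF (f : ℕ → ℝ) (v : ℕ → ℝ) : ℝ := ∑' ℓ, gOf f ℓ * du v ℓ

/-- partial derivatives of the bulk site potential -/
def d1V (V : ℝ → ℝ → ℝ) (r s : ℝ) : ℝ := deriv (fun t => V t s) r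
def d2V (V : ℝ → ℝ → ℝ) (r s : ℝ) : ℝ := deriv (fun t => V r t) s
def d11V (V : ℝ → ℝ → ℝ) (r s : ℝ) : ℝ := deriv (fun t => d1V V t s) r
def d12V (V : ℝ → ℝ → ℝ) (r s : ℝ) : ℝ := deriv (fun t => d1V V r t) s
def d22V (V : ℝ → ℝ → ℝ) (r s : ℝ) : ℝ := deriv (fun t => d2V V r t) s

/-- Cauchy–Born energy density `W(F) = V(F,F)` and its derivatives -/
def Wcb (V : ℝ → ℝ → ℝ) (F : ℝ) : ℝ := V F F
def dW (V : ℝ → ℝ → ℝ) (F : ℝ) : ℝ := deriv (Wcb V) F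
def d2W (V : ℝ → ℝ → ℝ) (F : ℝ) : ℝ := deriv (dW V) F

/-- standing assumptions (i)–(vi) on the site energies -/
structure SiteAssumptions (V : ℝ → ℝ → ℝ) (Vs : ℝ → ℝ) : Prop where
  smooth_V : ContDiff ℝ 3 (Function.uncurry V)
  smooth_Vs : ContDiff ℝ 3 Vs
  bdd_V : ∀ i : ℕ, i ≤ 3 → ∃ B : ℝ, ∀ p : ℝ × ℝ,
    ‖iteratedFDeriv ℝ i (Function.uncurry V) p‖ ≤ B
  bdd_Vs : ∀ i : ℕ, i ≤ 3 → ∃ B : ℝ, ∀ x : ℝ, ‖iteratedFDeriv ℝ i Vs x‖ ≤ B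
  V_zero : V 0 0 = 0
  posdef : ∀ p : ℝ × ℝ, p ≠ 0 →
    0 < d11V V 0 0 * p.1 ^ 2 + 2 * d12V V 0 0 * p.1 * p.2 + d22V V 0 0 * p.2 ^ 2
  pos_away : ∀ ε : ℝ, 0 < ε → ∃ δ : ℝ, 0 < δ ∧
    ∀ r s : ℝ, ε < Real.sqrt (r ^ 2 + s ^ 2) → δ ≤ V r s
  surf_limit : ∀ s : ℝ, Tendsto (fun r => V r s) atTop (nhds (Vs s))

/-- atomistic energy, with values in `[0,∞]` (the site energies are nonnegative
under the standing assumptions) -/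
def EaE (V : ℝ → ℝ → ℝ) (Vs : ℝ → ℝ) (u : ℕ → ℝ) : ℝ≥0∞ :=
  ENNReal.ofReal (Vs (du u 0)) +
    ∑' ℓ : ℕ, ENNReal.ofReal (V (du u ℓ) (du u (ℓ + 1)))

/-- ground state: global minimizer of the atomistic energy over 𝒰 -/
def GroundState (V : ℝ → ℝ → ℝ) (Vs : ℝ → ℝ) (u : ℕ → ℝ) : Prop :=
  memU u ∧ ∀ w : ℕ → ℝ, memU w → EaE V Vs u ≤ EaE V Vs w

/-- first variation of 𝓔ᵃ, as a function of the strain sequence `e` -/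
def fvA (V : ℝ → ℝ → ℝ) (Vs : ℝ → ℝ) (e : ℕ → ℝ) (v : ℕ → ℝ) : ℝ :=
  du v 0 * (deriv Vs (e 0) + d1V V (e 0) (e 1)) +
    ∑' ℓ : ℕ, du v (ℓ + 1) *
      (d2V V (e ℓ) (e (ℓ + 1)) + d1V V (e (ℓ + 1)) (e (ℓ + 2)))

/-- second variation (of 𝓔ᵃ, and of 𝓔^Γ) as a function of the strain sequence `e` -/
def svA (V : ℝ → ℝ → ℝ) (Vs : ℝ → ℝ) (e : ℕ → ℝ) (v : ℕ → ℝ) : ℝ :=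
  deriv (deriv Vs) (e 0) * (du v 0) ^ 2 +
    ∑' ℓ : ℕ, (d11V V (e ℓ) (e (ℓ + 1)) * (du v ℓ) ^ 2
      + 2 * d12V V (e ℓ) (e (ℓ + 1)) * du v ℓ * du v (ℓ + 1)
      + d22V V (e ℓ) (e (ℓ + 1)) * (du v (ℓ + 1)) ^ 2)

/-- a strongly stable ground state with stability constant `c` -/
def StronglyStableGS (V : ℝ → ℝ → ℝ) (Vs : ℝ → ℝ) (u : ℕ → ℝ) (c : ℝ) : Prop :=
  GroundState V Vs u ∧ 0 < c ∧
    ∀ v : ℕ → ℝ, memU v → c * ∑' ℓ, (du v ℓ) ^ 2 ≤ svA V Vs (du u) v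

/-- critical point of 𝓔ᵃ: the pointwise Euler–Lagrange equations -/
def CriticalA (V : ℝ → ℝ → ℝ) (Vs : ℝ → ℝ) (u : ℕ → ℝ) : Prop :=
  deriv Vs (du u 0) + d1V V (du u 0) (du u 1) = 0 ∧
  ∀ ℓ : ℕ, d2V V (du u ℓ) (du u (ℓ + 1)) + d1V V (du u (ℓ + 1)) (du u (ℓ + 2)) = 0

/-- first variation of the corrector energy 𝓔^Γ(·;F₀) -/
def fvG (V : ℝ → ℝ → ℝ) (Vs : ℝ → ℝ) (F0 : ℝ) (q v : ℕ → ℝ) : ℝ :=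
  du v 0 * (deriv Vs (F0 + du q 0) + d1V V (F0 + du q 0) (F0 + du q 1) - dW V F0) +
    ∑' ℓ : ℕ, du v (ℓ + 1) *
      (d2V V (F0 + du q ℓ) (F0 + du q (ℓ + 1))
        + d1V V (F0 + du q (ℓ + 1)) (F0 + du q (ℓ + 2)) - dW V F0)

/-- critical point of the corrector energy: pointwise Euler–Lagrange equations -/
def CriticalG (V : ℝ → ℝ → ℝ) (Vs : ℝ → ℝ) (F0 : ℝ) (q : ℕ → ℝ) : Prop :=
  deriv Vs (F0 + du q 0) + d1V V (F0 + du q 0) (F0 + du q 1) - dW V F0 = 0 ∧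
  ∀ ℓ : ℕ, d2V V (F0 + du q ℓ) (F0 + du q (ℓ + 1))
      + d1V V (F0 + du q (ℓ + 1)) (F0 + du q (ℓ + 2)) - dW V F0 = 0

/-- second variation of the corrector energy at `q` -/
def svG (V : ℝ → ℝ → ℝ) (Vs : ℝ → ℝ) (F0 : ℝ) (q v : ℕ → ℝ) : ℝ :=
  svA V Vs (fun ℓ => F0 + du q ℓ) v

/-- membership in 𝒬_L -/
def memQL (L : ℕ) (q : ℕ → ℝ) : Prop := memU q ∧ ∀ ℓ : ℕ, L ≤ ℓ → du q ℓ = 0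

/-- continuous piecewise affine interpolant of a lattice function -/
def fAff (f : ℕ → ℝ) (x : ℝ) : ℝ :=
  f ⌊x⌋₊ + (x - (⌊x⌋₊ : ℝ)) * (f (⌊x⌋₊ + 1) - f ⌊x⌋₊)

/-- `g̃(x) = ∫_x^∞ f(s) ds`, improper integral of the interpolant -/
def gTilde (f : ℕ → ℝ) (x : ℝ) : ℝ :=
  limUnder atTop (fun K : ℕ => ∫ t in x..(K : ℝ), fAff f t)

/-- the Cauchy–Born continuum energy of a strain field `w = ∇u`, valued in `[0,∞]` -/
def EcbE (V : ℝ → ℝ → ℝ) (w : ℝ → ℝ) : ℝ≥0∞ :=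
  ∫⁻ x in Set.Ioi (0 : ℝ), ENNReal.ofReal (Wcb V (w x))

/-- strain of the projection `Π_a u^cb`, given the gradient `w = ∇u^cb` -/
def PiA (w : ℝ → ℝ) (ℓ : ℕ) : ℝ := ∫ t in (ℓ : ℝ)..((ℓ : ℝ) + 1), w t

/-- the data of "the" strongly stable Cauchy–Born solution for the force `f`:
`w = ∇u^cb`, `w1 = ∇²u^cb`, `w2 = ∇³u^cb`, with constant `Cw` -/
def CBSolution (V : ℝ → ℝ → ℝ) (f : ℕ → ℝ) (Cw : ℝ) (w w1 w2 : ℝ → ℝ) : Prop :=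
  MemLp w 2 (volume.restrict (Set.Ioi 0)) ∧
  (∀ᵐ x ∂(volume.restrict (Set.Ioi (0 : ℝ))), dW V (w x) = gTilde f x) ∧
  (∃ ccb : ℝ, 0 < ccb ∧ ∀ vw : ℝ → ℝ, MemLp vw 2 (volume.restrict (Set.Ioi 0)) →
    ccb * ∫ x in Set.Ioi (0 : ℝ), (vw x) ^ 2 ≤
      ∫ x in Set.Ioi (0 : ℝ), d2W V (w x) * (vw x) ^ 2) ∧
  (∀ x ∈ Set.Ici (0 : ℝ), HasDerivAt w (w1 x) x) ∧
  (∀ᵐ x ∂(volume.restrict (Set.Ioi (0 : ℝ))), HasDerivAt w1 (w2 x) x) ∧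
  |w 0| ≤ Cw * dualNorm f

theorem FinSupp.du {u : ℕ → ℝ} (hu : FinSupp u) : FinSupp (du u) := by
  obtain ⟨N, hN⟩ := hu
  exact ⟨N, fun ℓ hℓ => by simp [_root_.du, hN ℓ hℓ, hN (ℓ + 1) (by omega)]⟩

theorem FinSupp.summable_sq {u : ℕ → ℝ} (hu : FinSupp u) : Summable fun ℓ => (u ℓ) ^ 2 := by
  obtain ⟨N, hN⟩ := hu
  refine summable_of_ne_finset_zero (s := Finset.range N) fun ℓ hℓ => ?_
  simp [hN ℓ (by simpa using hℓ)]

theorem sum_mul_eq_sum_mul_du {f g : ℕ → ℝ} (hfg : ∀ k, f (k + 1) = g k - g (k + 1))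
    {u : ℕ → ℝ} (hu : u 0 = 0) (n : ℕ) :
    ∑ k ∈ Finset.range (n + 1), f k * u k =
      ∑ k ∈ Finset.range n, g k * du u k - g n * u n := by
  induction n with
  | zero => simp [hu]
  | succ n ih =>
    rw [Finset.sum_range_succ, ih, Finset.sum_range_succ (fun k => g k * du u k), hfg, du]
    ring

theorem tsum_mul_eq_tsum_mul_du {f g : ℕ → ℝ} (hfg : ∀ k, f (k + 1) = g k - g (k + 1))
    {u : ℕ → ℝ} (hu : u 0 = 0) (hs : FinSupp u) :
    ∑' ℓ, f ℓ * u ℓ = ∑' ℓ, g ℓ * du u ℓ := by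
  obtain ⟨N, hN⟩ := hs
  rw [tsum_eq_sum (s := Finset.range (N + 1)), tsum_eq_sum (s := Finset.range N),
    sum_mul_eq_sum_mul_du hfg hu, hN N le_rfl]
  · simp
  · intro ℓ hℓ
    have h : N ≤ ℓ := by simpa using hℓ
    simp [du, hN ℓ h, hN (ℓ + 1) (by omega)]
  · intro ℓ hℓ
    have h : N + 1 ≤ ℓ := by simpa using hℓ
    simp [hN ℓ (by omega)]

/-- Testing with the unit vectors turns the summation by parts identity into a recursion. -/
theorem eq_sub_of_tsum_mul_eq {f g : ℕ → ℝ}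
    (h : ∀ u : ℕ → ℝ, u 0 = 0 → FinSupp u → ∑' ℓ, f ℓ * u ℓ = ∑' ℓ, g ℓ * du u ℓ) (k : ℕ) :
    f (k + 1) = g k - g (k + 1) := by
  have hk := h (fun n => if n = k + 1 then 1 else 0) (by simp)
    ⟨k + 2, fun ℓ hℓ => if_neg (by omega)⟩
  rw [tsum_eq_single (k + 1) fun n hn => by simp [hn],
    tsum_eq_sum (s := {k, k + 1}) fun n hn => ?_, Finset.sum_pair (by omega)] at hk
  · simpa [du, sub_eq_add_neg] using hk
  · simp only [Finset.mem_insert, Finset.mem_singleton, not_or] at hn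
    simp [du, hn.1, hn.2]

theorem tendsto_sum_Ico {f g : ℕ → ℝ} (hfg : ∀ k, f (k + 1) = g k - g (k + 1))
    (hg : Summable fun ℓ => (g ℓ) ^ 2) (ℓ : ℕ) :
    Tendsto (fun K : ℕ => ∑ k ∈ Finset.Ico (ℓ + 1) K, f k) atTop (nhds (g ℓ)) := by
  have hg0 : Tendsto g atTop (nhds 0) := by
    simpa [Real.sqrt_sq_eq_abs, tendsto_zero_iff_abs_tendsto_zero, Function.comp_def] using
      hg.tendsto_atTop_zero.sqrt
  have hsum : ∀ n, ∑ k ∈ Finset.Ico (ℓ + 1) (ℓ + 1 + n), f k = g ℓ - g (n + ℓ) := by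
    intro n
    induction n with
    | zero => simp
    | succ n ih =>
      rw [← add_assoc, Finset.sum_Ico_succ_top (by omega), ih,
        show ℓ + 1 + n = n + ℓ + 1 by omega, hfg, show n + 1 + ℓ = n + ℓ + 1 by omega]
      ring
  rw [← tendsto_add_atTop_iff_nat (ℓ + 1)]
  simp_rw [add_comm _ (ℓ + 1), hsum]
  simpa using ((tendsto_add_atTop_iff_nat ℓ).2 hg0).const_sub (g ℓ)

theorem abs_tsum_mul_le_l2 {a b : ℕ → ℝ} (ha : Summable fun ℓ => (a ℓ) ^ 2)
    (hb : Summable fun ℓ => (b ℓ) ^ 2) : |∑' ℓ, a ℓ * b ℓ| ≤ l2 a * l2 b := by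
  have ha' : Summable fun ℓ => |a ℓ| ^ (2 : ℝ) := by simpa using ha
  have hb' : Summable fun ℓ => |b ℓ| ^ (2 : ℝ) := by simpa using hb
  have hsum := Real.summable_mul_of_Lp_Lq_of_nonneg Real.HolderConjugate.two_two
    (fun ℓ => abs_nonneg (a ℓ)) (fun ℓ => abs_nonneg (b ℓ)) ha' hb'
  have hle := Real.inner_le_Lp_mul_Lq_tsum_of_nonneg Real.HolderConjugate.two_two
    (fun ℓ => abs_nonneg (a ℓ)) (fun ℓ => abs_nonneg (b ℓ)) ha' hb'
  simp only [← abs_mul, Real.rpow_two, sq_abs, ← Real.sqrt_eq_rpow] at hsum hle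
  rw [l2, l2]
  refine le_trans ?_ hle
  simpa only [Real.norm_eq_abs] using norm_tsum_le_tsum_norm (f := fun ℓ => a ℓ * b ℓ) hsum

/-- The mean-free truncation of `c - F` is the strain of a compactly supported displacement. -/
theorem sum_sub_sq_le {f F : ℕ → ℝ} {M c : ℝ} {N : ℕ}
    (hM : ∀ u : ℕ → ℝ, u 0 = 0 → FinSupp u → |∑' ℓ, f ℓ * u ℓ| ≤ M * l2 (du u))
    (hF : ∀ k, f (k + 1) = F (k + 1) - F k)
    (hc : ∑ ℓ ∈ Finset.range N, (c - F ℓ) = 0) :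
    ∑ ℓ ∈ Finset.range N, (c - F ℓ) ^ 2 ≤ M ^ 2 := by
  set e : ℕ → ℝ := fun ℓ => if ℓ < N then c - F ℓ else 0 with he
  set u : ℕ → ℝ := fun n => ∑ ℓ ∈ Finset.range n, e ℓ with hu
  have hdu : du u = e := by
    ext ℓ
    simp [du, hu, Finset.sum_range_succ]
  have hu0 : u 0 = 0 := by simp [hu]
  have heN : ∀ ℓ ∉ Finset.range N, e ℓ = 0 := fun ℓ hℓ => if_neg (by simpa using hℓ)
  have hsupp : FinSupp u := by
    refine ⟨N, fun ℓ hℓ => ?_⟩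
    rw [← hc, hu]
    refine (Finset.sum_subset (Finset.range_mono hℓ) fun n _ hn => heN n hn).symm.trans ?_
    exact Finset.sum_congr rfl fun n hn => if_pos (Finset.mem_range.1 hn)
  set A := ∑ ℓ ∈ Finset.range N, (c - F ℓ) ^ 2 with hA
  have hA0 : 0 ≤ A := Finset.sum_nonneg fun _ _ => sq_nonneg _
  have hpair : ∑' ℓ, f ℓ * u ℓ = A := by
    rw [tsum_mul_eq_tsum_mul_du (g := fun ℓ => c - F ℓ) (fun k => by rw [hF]; ring) hu0 hsupp,
      hdu, tsum_eq_sum (s := Finset.range N) fun ℓ hℓ => by simp [heN ℓ hℓ]]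
    refine Finset.sum_congr rfl fun n hn => ?_
    simp [he, Finset.mem_range.1 hn, sq]
  have hnorm : l2 (du u) = Real.sqrt A := by
    rw [l2, hdu, tsum_eq_sum (s := Finset.range N) fun ℓ hℓ => by simp [heN ℓ hℓ]]
    congr 1
    refine Finset.sum_congr rfl fun n hn => ?_
    simp [he, Finset.mem_range.1 hn]
  have hle := hM u hu0 hsupp
  rw [hpair, hnorm, abs_of_nonneg hA0] at hle
  nlinarith [Real.sq_sqrt hA0, sq_nonneg (M - Real.sqrt A)]

theorem exists_summable_sq_of_bound {f : ℕ → ℝ} {M : ℝ}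
    (hM : ∀ u : ℕ → ℝ, u 0 = 0 → FinSupp u → |∑' ℓ, f ℓ * u ℓ| ≤ M * l2 (du u)) :
    ∃ g : ℕ → ℝ, (∀ k, f (k + 1) = g k - g (k + 1)) ∧ Summable (fun ℓ => (g ℓ) ^ 2) ∧
      ∑' ℓ, (g ℓ) ^ 2 ≤ M ^ 2 := by
  set F : ℕ → ℝ := fun n => ∑ k ∈ Finset.range n, f (k + 1) with hFdef
  have hF : ∀ k, f (k + 1) = F (k + 1) - F k := fun k => by
    simp [hFdef, Finset.sum_range_succ]
  set c : ℕ → ℝ := fun N => (∑ ℓ ∈ Finset.range (N + 1), F ℓ) / ((N + 1 : ℕ) : ℝ) with hc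
  have hbound : ∀ N, ∑ ℓ ∈ Finset.range (N + 1), (c N - F ℓ) ^ 2 ≤ M ^ 2 := fun N => by
    refine sum_sub_sq_le hM hF ?_
    rw [Finset.sum_sub_distrib, Finset.sum_const, Finset.card_range, nsmul_eq_mul, hc]
    field_simp
    simp
  have hpartial : ∀ K N, K ≤ N + 1 → ∑ ℓ ∈ Finset.range K, (c N - F ℓ) ^ 2 ≤ M ^ 2 :=
    fun K N h => (Finset.sum_le_sum_of_subset_of_nonneg (Finset.range_mono h)
      fun _ _ _ => sq_nonneg _).trans (hbound N)
  have hcM : ∀ N, c N ∈ Set.Icc (-|M|) |M| := fun N => by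
    have h := hpartial 1 N (by omega)
    simp only [Finset.range_one, Finset.sum_singleton] at h
    have hF0 : F 0 = 0 := by simp [hFdef]
    rw [hF0, sub_zero] at h
    exact abs_le.1 (sq_le_sq.1 h)
  obtain ⟨a, -, φ, hφ, ha⟩ := isCompact_Icc.tendsto_subseq hcM
  have hlim : ∀ K, ∑ ℓ ∈ Finset.range K, (a - F ℓ) ^ 2 ≤ M ^ 2 := fun K => by
    refine le_of_tendsto (tendsto_finsetSum (Finset.range K)
      fun ℓ _ => (ha.sub_const (F ℓ)).pow 2) ?_
    filter_upwards [eventually_ge_atTop K] with j hj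
    exact hpartial K (φ j) ((hj.trans (hφ.id_le j)).trans (Nat.le_succ _))
  exact ⟨fun ℓ => a - F ℓ, fun k => by rw [hF]; ring,
    summable_of_sum_range_le (fun _ => sq_nonneg _) hlim,
    Real.tsum_le_of_sum_range_le (fun _ => sq_nonneg _) hlim⟩

/-- characterization of 𝒰* by summation by parts: `f ∈ 𝒰*` iff
`⟨f,u⟩ = ⟨g,u'⟩` for some `g ∈ ℓ²`; such `g` is unique, given by
`g_ℓ = Σ_{k=ℓ+1}^∞ f_k`, and `‖f‖_{𝒰*} = ‖g‖_{ℓ²}`. -/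
theorem dual_space_characterization (f : ℕ → ℝ) :
    (memUstar f ↔ ∃ g : ℕ → ℝ, Summable (fun ℓ => (g ℓ) ^ 2) ∧
      ∀ u : ℕ → ℝ, u 0 = 0 → FinSupp u →
        ∑' ℓ, f ℓ * u ℓ = ∑' ℓ, g ℓ * du u ℓ) ∧
    -- uniqueness of g
    (∀ g₁ g₂ : ℕ → ℝ, Summable (fun ℓ => (g₁ ℓ) ^ 2) →
      Summable (fun ℓ => (g₂ ℓ) ^ 2) →
      (∀ u : ℕ → ℝ, u 0 = 0 → FinSupp u →
        ∑' ℓ, f ℓ * u ℓ = ∑' ℓ, g₁ ℓ * du u ℓ) →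
      (∀ u : ℕ → ℝ, u 0 = 0 → FinSupp u →
        ∑' ℓ, f ℓ * u ℓ = ∑' ℓ, g₂ ℓ * du u ℓ) → g₁ = g₂) ∧
    -- formula for g and the dual norm
    (∀ g : ℕ → ℝ, Summable (fun ℓ => (g ℓ) ^ 2) →
      (∀ u : ℕ → ℝ, u 0 = 0 → FinSupp u →
        ∑' ℓ, f ℓ * u ℓ = ∑' ℓ, g ℓ * du u ℓ) →
      (∀ ℓ : ℕ, Tendsto (fun K : ℕ => ∑ k ∈ Finset.Ico (ℓ + 1) K, f k) atTop
        (nhds (g ℓ))) ∧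
      dualNorm f = Real.sqrt (∑' ℓ, (g ℓ) ^ 2)) := by
  have huniq : ∀ g₁ g₂ : ℕ → ℝ, Summable (fun ℓ => (g₁ ℓ) ^ 2) →
      Summable (fun ℓ => (g₂ ℓ) ^ 2) → (∀ k, f (k + 1) = g₁ k - g₁ (k + 1)) →
      (∀ k, f (k + 1) = g₂ k - g₂ (k + 1)) → g₁ = g₂ := fun g₁ g₂ h₁ h₂ e₁ e₂ =>
    funext fun ℓ => tendsto_nhds_unique (tendsto_sum_Ico e₁ h₁ ℓ) (tendsto_sum_Ico e₂ h₂ ℓ)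
  have hle : ∀ g : ℕ → ℝ, Summable (fun ℓ => (g ℓ) ^ 2) →
      (∀ u : ℕ → ℝ, u 0 = 0 → FinSupp u → ∑' ℓ, f ℓ * u ℓ = ∑' ℓ, g ℓ * du u ℓ) →
      ∀ u : ℕ → ℝ, u 0 = 0 → FinSupp u → |∑' ℓ, f ℓ * u ℓ| ≤ l2 g * l2 (du u) :=
    fun g hg h u hu hs => (h u hu hs).symm ▸ abs_tsum_mul_le_l2 hg hs.du.summable_sq
  refine ⟨⟨?_, ?_⟩, ?_, ?_⟩
  · rintro ⟨M, hM⟩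
    obtain ⟨g, hfg, hg, -⟩ := exists_summable_sq_of_bound hM
    exact ⟨g, hg, fun u hu hs => tsum_mul_eq_tsum_mul_du hfg hu hs⟩
  · rintro ⟨g, hg, h⟩
    exact ⟨l2 g, hle g hg h⟩
  · exact fun g₁ g₂ h₁ h₂ e₁ e₂ =>
      huniq g₁ g₂ h₁ h₂ (eq_sub_of_tsum_mul_eq e₁) (eq_sub_of_tsum_mul_eq e₂)
  · intro g hg h
    have hfg := eq_sub_of_tsum_mul_eq h
    refine ⟨tendsto_sum_Ico hfg hg, IsLeast.csInf_eq ⟨⟨Real.sqrt_nonneg _, hle g hg h⟩, ?_⟩⟩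
    rintro M ⟨hM0, hM⟩
    obtain ⟨g', hfg', hg', hnorm⟩ := exists_summable_sq_of_bound hM
    rw [huniq g g' hg hg' hfg hfg']
    exact Real.sqrt_le_iff.2 ⟨hM0, hnorm⟩
end
end

section
/- Let w, q ∈ 𝒰, u := w + q, and F₀ ∈ ℝ. Then there is a constant C (depending only on the bounds and Lipschitz constants of the derivatives of V and V^surf up to third order) such that for all v ∈ 𝒰, |⟨δ𝓔ᵃ(u) − δ𝓔^cb,disc(w; F₀) − δ𝓔^Γ(q; F₀), v⟩| ≤ C[ ‖w''‖²_{ℓ⁴(ℤ_{≥0})} + ‖w'''‖_{ℓ²(ℤ_{>0})} + ‖q''·w''‖_{ℓ²(ℤ_{≥0})} + |w'₀ − F₀| + |w'₁ − F₀| + (Σ_{ℓ=1}^∞ (|q'_{ℓ−1}| + |q'_ℓ| + |q'_{ℓ+1}|)² |w'_ℓ − F₀|²)^{1/2} ] · ‖v'‖_{ℓ²}. -/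
open scoped BigOperators ENNReal
open Filter MeasureTheory

noncomputable section

section Calculus

variable {E F : Type*} [NormedAddCommGroup E] [NormedSpace ℝ E]
  [NormedAddCommGroup F] [NormedSpace ℝ F]

lemma norm_sub_le_of_norm_fderiv_le {f : E → F} {M : ℝ} (hf : Differentiable ℝ f)
    (hM : ∀ x, ‖fderiv ℝ f x‖ ≤ M) (x y : E) : ‖f x - f y‖ ≤ M * ‖x - y‖ :=
  convex_univ.norm_image_sub_le_of_norm_fderiv_le (fun z _ => hf z) (fun z _ => hM z)
    (Set.mem_univ y) (Set.mem_univ x)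

/-- First-order Taylor estimate for a map with Lipschitz derivative. -/
lemma norm_taylor_one_le {f : E → F} {M : ℝ} (hf : Differentiable ℝ f) (hM0 : 0 ≤ M)
    (hM : ∀ x y, ‖fderiv ℝ f x - fderiv ℝ f y‖ ≤ M * ‖x - y‖) (x h : E) :
    ‖f (x + h) - f x - fderiv ℝ f x h‖ ≤ M * ‖h‖ ^ 2 := by
  have key := (convex_segment x (x + h)).norm_image_sub_le_of_norm_fderiv_le'
    (f := f) (φ := fderiv ℝ f x) (C := M * ‖h‖) (x := x) (y := x + h) (fun z _ => hf z)
    (fun z hz => ?_) (left_mem_segment ℝ _ _) (right_mem_segment ℝ _ _)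
  · simpa [pow_two, mul_assoc] using key
  · refine (hM z x).trans (mul_le_mul_of_nonneg_left ?_ hM0)
    simpa using norm_sub_le_of_mem_segment hz

/-- Mixed second difference estimate for a map with Lipschitz derivative. -/
lemma norm_mixed_difference_le {f : E → F} {M : ℝ} (hf : Differentiable ℝ f)
    (hM : ∀ x y, ‖fderiv ℝ f x - fderiv ℝ f y‖ ≤ M * ‖x - y‖) (x h k : E) :
    ‖(f (x + k + h) - f (x + k)) - (f (x + h) - f x)‖ ≤ M * ‖h‖ * ‖k‖ := by
  have hg : ∀ z, HasFDerivAt (fun z => f (z + h) - f z)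
      (fderiv ℝ f (z + h) - fderiv ℝ f z) z := fun z =>
    ((hasFDerivAt_comp_add_right h).2 (hf (z + h)).hasFDerivAt).sub (hf z).hasFDerivAt
  have := norm_sub_le_of_norm_fderiv_le (f := fun z => f (z + h) - f z) (M := M * ‖h‖)
    (fun z => (hg z).differentiableAt)
    (fun z => by rw [(hg z).fderiv]; simpa using hM (z + h) z) (x + k) x
  simpa using this

lemma norm_fderiv_fderiv_eq (f : E → F) (x : E) :
    ‖fderiv ℝ (fderiv ℝ f) x‖ = ‖iteratedFDeriv ℝ 2 f x‖ := by
  rw [← norm_iteratedFDeriv_one, norm_iteratedFDeriv_fderiv]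

lemma norm_fderiv_fderiv_sub_le {f : E → F} {M : ℝ} (hf : ContDiff ℝ 3 f)
    (hM : ∀ x, ‖iteratedFDeriv ℝ 3 f x‖ ≤ M) (x y : E) :
    ‖fderiv ℝ (fderiv ℝ f) x - fderiv ℝ (fderiv ℝ f) y‖ ≤ M * ‖x - y‖ := by
  have hA : ContDiff ℝ 2 (fderiv ℝ f) := hf.fderiv_right (by norm_num)
  have hH : ContDiff ℝ 1 (fderiv ℝ (fderiv ℝ f)) := hA.fderiv_right (by norm_num)
  refine norm_sub_le_of_norm_fderiv_le (hH.differentiable (by norm_num)) (fun z => ?_) x y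
  rw [← norm_iteratedFDeriv_one, norm_iteratedFDeriv_fderiv, norm_iteratedFDeriv_fderiv]
  exact hM z

end Calculus

section SquareSummable

lemma summable_mul_and_abs_tsum_le {f g : ℕ → ℝ} (hf : Summable fun i => f i ^ 2)
    (hg : Summable fun i => g i ^ 2) :
    Summable (fun i => |f i| * |g i|) ∧
      ∑' i, |f i| * |g i| ≤ √(∑' i, f i ^ 2) * √(∑' i, g i ^ 2) := by
  have key := Real.summable_and_inner_le_Lp_mul_Lq_tsum_of_nonneg (p := 2) (q := 2)
    (f := fun i => |f i|) (g := fun i => |g i|)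
    Real.HolderConjugate.two_two (fun i => abs_nonneg _) (fun i => abs_nonneg _)
    (by simpa using hf) (by simpa using hg)
  simpa [Real.sqrt_eq_rpow] using key

lemma summable_sq_mul_sq {f g : ℕ → ℝ} (hf : Summable fun i => f i ^ 2)
    (hg : Summable fun i => g i ^ 2) : Summable fun i => f i ^ 2 * g i ^ 2 :=
  Summable.of_nonneg_of_le (fun _ => by positivity)
    (fun i => mul_le_mul_of_nonneg_right (hf.le_tsum i fun _ _ => sq_nonneg _) (sq_nonneg _))
    (hg.mul_left _)

lemma summable_sq_sub {f g : ℕ → ℝ} (hf : Summable fun i => f i ^ 2)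
    (hg : Summable fun i => g i ^ 2) : Summable fun i => (f i - g i) ^ 2 :=
  Summable.of_nonneg_of_le (fun _ => sq_nonneg _)
    (fun i => by nlinarith [sq_nonneg (f i + g i)]) ((hf.mul_left 2).add (hg.mul_left 2))

lemma summable_sq_add {f g : ℕ → ℝ} (hf : Summable fun i => f i ^ 2)
    (hg : Summable fun i => g i ^ 2) : Summable fun i => (f i + g i) ^ 2 := by
  simpa using summable_sq_sub hf (g := fun i => - g i) (by simpa using hg)

lemma sqrt_tsum_succ_le {f : ℕ → ℝ} (hf : Summable f) (h0 : ∀ i, 0 ≤ f i) :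
    √(∑' i, f (i + 1)) ≤ √(∑' i, f i) := by
  refine Real.sqrt_le_sqrt ?_
  rw [hf.tsum_eq_zero_add]
  linarith [h0 0]

lemma abs_le_l2 {f : ℕ → ℝ} (hf : Summable fun i => f i ^ 2) (i : ℕ) : |f i| ≤ l2 f :=
  Real.abs_le_sqrt (hf.le_tsum i fun _ _ => sq_nonneg _)

/-- Summation of a termwise bound by six square summable families. -/
lemma abs_tsum_mul_le {v T f₁ f₂ f₃ f₄ f₅ f₆ : ℕ → ℝ} {K : ℝ}
    (hv : Summable fun i => v i ^ 2)
    (h₁ : Summable fun i => f₁ i ^ 2) (h₂ : Summable fun i => f₂ i ^ 2)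
    (h₃ : Summable fun i => f₃ i ^ 2) (h₄ : Summable fun i => f₄ i ^ 2)
    (h₅ : Summable fun i => f₅ i ^ 2) (h₆ : Summable fun i => f₆ i ^ 2) (hK : 0 ≤ K)
    (hT : ∀ i, |T i| ≤ K * (|f₁ i| + |f₂ i| + |f₃ i| + |f₄ i| + |f₅ i| + 2 * |f₆ i|)) :
    |∑' i, v i * T i| ≤ K * (√(∑' i, f₁ i ^ 2) + √(∑' i, f₂ i ^ 2) + √(∑' i, f₃ i ^ 2)
      + √(∑' i, f₄ i ^ 2) + √(∑' i, f₅ i ^ 2) + 2 * √(∑' i, f₆ i ^ 2))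
      * √(∑' i, v i ^ 2) := by
  obtain ⟨s₁, b₁⟩ := summable_mul_and_abs_tsum_le hv h₁
  obtain ⟨s₂, b₂⟩ := summable_mul_and_abs_tsum_le hv h₂
  obtain ⟨s₃, b₃⟩ := summable_mul_and_abs_tsum_le hv h₃
  obtain ⟨s₄, b₄⟩ := summable_mul_and_abs_tsum_le hv h₄
  obtain ⟨s₅, b₅⟩ := summable_mul_and_abs_tsum_le hv h₅
  obtain ⟨s₆, b₆⟩ := summable_mul_and_abs_tsum_le hv h₆
  have hsum := ((((((s₁.hasSum.add s₂.hasSum).add s₃.hasSum).add s₄.hasSum).add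
    s₅.hasSum).add (s₆.hasSum.mul_left 2)).mul_left K)
  have := tsum_of_norm_bounded (f := fun i => v i * T i) hsum fun i => by
    rw [Real.norm_eq_abs, abs_mul]
    calc |v i| * |T i| ≤ |v i| * _ := mul_le_mul_of_nonneg_left (hT i) (abs_nonneg _)
      _ = _ := by ring
  rw [Real.norm_eq_abs] at this
  refine this.trans ?_
  rw [mul_assoc]
  refine mul_le_mul_of_nonneg_left ?_ hK
  linarith

end SquareSummable

section SitePotential

variable {V : ℝ → ℝ → ℝ}

lemma d1V_eq_fderiv (hV : Differentiable ℝ (Function.uncurry V)) (r s : ℝ) :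
    d1V V r s = fderiv ℝ (Function.uncurry V) (r, s) (1, 0) := by
  have h := (hV (r, s)).hasFDerivAt.comp_hasDerivAt r
    ((hasDerivAt_id r).prodMk (hasDerivAt_const r s))
  exact h.deriv

lemma d2V_eq_fderiv (hV : Differentiable ℝ (Function.uncurry V)) (r s : ℝ) :
    d2V V r s = fderiv ℝ (Function.uncurry V) (r, s) (0, 1) := by
  have h := (hV (r, s)).hasFDerivAt.comp_hasDerivAt s
    ((hasDerivAt_const s r).prodMk (hasDerivAt_id s))
  exact h.deriv

lemma dW_eq_add (hV : Differentiable ℝ (Function.uncurry V)) (x : ℝ) :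
    dW V x = d2V V x x + d1V V x x := by
  have h := HasFDerivAt.comp_hasDerivAt (f := fun t : ℝ => (t, t)) x
    (hV (x, x)).hasFDerivAt ((hasDerivAt_id x).prodMk (hasDerivAt_id x))
  rw [d1V_eq_fderiv hV, d2V_eq_fderiv hV, ← map_add, Prod.mk_add_mk, zero_add, add_zero]
  exact h.deriv

lemma abs_apply_le_norm (L : ℝ × ℝ →L[ℝ] ℝ) {e : ℝ × ℝ} (he : ‖e‖ = 1) : |L e| ≤ ‖L‖ := by
  simpa [he] using L.le_opNorm e

/-- The interior consistency error at one site. -/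
lemma abs_site_error_le {M : ℝ} (hM0 : 0 ≤ M) (hV : ContDiff ℝ 3 (Function.uncurry V))
    (h2 : ∀ x, ‖iteratedFDeriv ℝ 2 (Function.uncurry V) x‖ ≤ M)
    (h3 : ∀ x, ‖iteratedFDeriv ℝ 3 (Function.uncurry V) x‖ ≤ M)
    (a b c p q r F : ℝ) :
    |(d2V V (a + p) (b + q) + d1V V (b + q) (c + r)) - dW V b
      - (d2V V (F + p) (F + q) + d1V V (F + q) (F + r) - dW V F)| ≤
    M * (|(b - a) ^ 2| + |(c - b) ^ 2| + |c - 2 * b + a| + |(q - p) * (b - a)|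
      + |(r - q) * (c - b)| + 2 * |(|p| + |q| + |r|) * (b - F)|) := by
  have hVd : Differentiable ℝ (Function.uncurry V) := hV.differentiable (by norm_num)
  have hA2 : ContDiff ℝ 2 (fderiv ℝ (Function.uncurry V)) :=
    hV.fderiv_right (by norm_num)
  have hsymm : ∀ x y z, fderiv ℝ (fderiv ℝ (Function.uncurry V)) x y z
      = fderiv ℝ (fderiv ℝ (Function.uncurry V)) x z y := fun x y z =>
    second_derivative_symmetric (fun x => (hVd x).hasFDerivAt)
      ((hA2.differentiable (by norm_num)) x).hasFDerivAt y z
  simp only [dW_eq_add hVd, d1V_eq_fderiv hVd, d2V_eq_fderiv hVd]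
  have hAd : Differentiable ℝ (fderiv ℝ (Function.uncurry V)) :=
    hA2.differentiable (by norm_num)
  have hHb : ∀ x, ‖fderiv ℝ (fderiv ℝ (Function.uncurry V)) x‖ ≤ M := fun x => by
    rw [norm_fderiv_fderiv_eq]; exact h2 x
  have hHL := norm_fderiv_fderiv_sub_le hV h3
  generalize fderiv ℝ (Function.uncurry V) = A at *
  have n1 : ‖((1 : ℝ), (0 : ℝ))‖ = 1 := by simp [Prod.norm_def]
  have n2 : ‖((0 : ℝ), (1 : ℝ))‖ = 1 := by simp [Prod.norm_def]
  have t1 := (abs_apply_le_norm _ n2).trans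
    (norm_taylor_one_le hAd hM0 hHL (b + p, b + q) ((a - b) • ((1 : ℝ), (0 : ℝ))))
  have t2 := (abs_apply_le_norm _ n1).trans
    (norm_taylor_one_le hAd hM0 hHL (b + q, b + r) ((c - b) • ((0 : ℝ), (1 : ℝ))))
  have m1 := (abs_apply_le_norm _ n2).trans
    (norm_mixed_difference_le hAd hHL (F, F) (p, q) (b - F, b - F))
  have m2 := (abs_apply_le_norm _ n1).trans
    (norm_mixed_difference_le hAd hHL (F, F) (q, r) (b - F, b - F))
  have l1 := (abs_apply_le_norm _ n2).trans
    (((fderiv ℝ A (b + p, b + q) - fderiv ℝ A (b + q, b + q)).le_opNorm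
      ((1 : ℝ), (0 : ℝ))).trans
      (mul_le_mul_of_nonneg_right (hHL (b + p, b + q) (b + q, b + q)) (norm_nonneg _)))
  have l2 := (abs_apply_le_norm _ n2).trans
    (((fderiv ℝ A (b + q, b + r) - fderiv ℝ A (b + q, b + q)).le_opNorm
      ((1 : ℝ), (0 : ℝ))).trans
      (mul_le_mul_of_nonneg_right (hHL (b + q, b + r) (b + q, b + q)) (norm_nonneg _)))
  have l3 := (abs_apply_le_norm _ n2).trans
    (((fderiv ℝ A (b + q, b + q)).le_opNorm ((1 : ℝ), (0 : ℝ))).trans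
      (mul_le_mul_of_nonneg_right (hHb (b + q, b + q)) (norm_nonneg _)))
  rw [norm_smul, n1, map_smul] at t1
  rw [norm_smul, n2, map_smul] at t2
  rw [n1] at l1 l2 l3
  have s2 := hsymm (b + q, b + r) (0, 1) (1, 0)
  simp only [Prod.mk_add_mk, Prod.mk_sub_mk, Prod.smul_mk, Prod.norm_mk, smul_eq_mul, mul_one,
    mul_zero, add_zero, sub_apply, smul_apply, s2,
    Real.norm_eq_abs, add_sub_cancel, sq_abs, sub_self, abs_zero, max_self,
    add_sub_add_left_eq_sub] at t1 t2 m1 m2 l1 l2 l3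
  rw [show b + p + (a - b) = a + p by ring] at t1
  rw [show b + r + (c - b) = c + r by ring] at t2
  rw [max_eq_left (abs_nonneg _), abs_sub_comm p q] at l1
  rw [max_eq_right (abs_nonneg _)] at l2
  have k1 := mul_le_mul_of_nonneg_left l1 (abs_nonneg (a - b))
  have k2 := mul_le_mul_of_nonneg_left l2 (abs_nonneg (c - b))
  have k3 := mul_le_mul_of_nonneg_left l3 (abs_nonneg (c - 2 * b + a))
  rw [← abs_mul] at k1 k2 k3
  have hpos : ∀ x y z : ℝ, 0 ≤ z → x ≤ y → M * x * z ≤ M * y * z := fun x y z hz hxy =>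
    mul_le_mul_of_nonneg_right (mul_le_mul_of_nonneg_left hxy hM0) hz
  have mm1 := m1.trans (hpos _ (|p| + |q| + |r|) _ (abs_nonneg _)
    (max_le (by linarith [abs_nonneg q, abs_nonneg r]) (by linarith [abs_nonneg p, abs_nonneg r])))
  have mm2 := m2.trans (hpos _ (|p| + |q| + |r|) _ (abs_nonneg _)
    (max_le (by linarith [abs_nonneg p, abs_nonneg r]) (by linarith [abs_nonneg p, abs_nonneg q])))
  have hS : 0 ≤ |p| + |q| + |r| := by positivity
  rw [abs_mul (q - p), abs_mul (r - q), abs_mul (|p| + |q| + |r|), abs_of_nonneg hS,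
    abs_of_nonneg (sq_nonneg (b - a)), abs_of_nonneg (sq_nonneg (c - b)), abs_sub_comm b a]
  rw [abs_le] at t1 t2 mm1 mm2 k1 k2 k3 ⊢
  constructor <;>
    linarith [t1.1, t1.2, t2.1, t2.2, mm1.1, mm1.2, mm2.1, mm2.2, k1.1, k1.2, k2.1, k2.2,
      k3.1, k3.2]

/-- The consistency error at the boundary site. -/
lemma abs_boundary_error_le {Vs : ℝ → ℝ} {M : ℝ} (hM0 : 0 ≤ M)
    (hV : ContDiff ℝ 3 (Function.uncurry V))
    (h2 : ∀ x, ‖iteratedFDeriv ℝ 2 (Function.uncurry V) x‖ ≤ M)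
    (hVs : ContDiff ℝ 3 Vs) (hs : ∀ x, ‖iteratedFDeriv ℝ 2 Vs x‖ ≤ M) (a b p q F : ℝ) :
    |(deriv Vs (a + p) + d1V V (a + p) (b + q)) - dW V F
      - (deriv Vs (F + p) + d1V V (F + p) (F + q) - dW V F)| ≤
    M * (2 * |a - F| + |b - F|) := by
  have hVd : Differentiable ℝ (Function.uncurry V) := hV.differentiable (by norm_num)
  have hA2 : ContDiff ℝ 2 (fderiv ℝ (Function.uncurry V)) :=
    hV.fderiv_right (by norm_num)
  have hB2 : ContDiff ℝ 2 (fderiv ℝ Vs) := hVs.fderiv_right (by norm_num)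
  have n1 : ‖((1 : ℝ), (0 : ℝ))‖ = 1 := by simp [Prod.norm_def]
  have k1 := (abs_apply_le_norm _ n1).trans
    (norm_sub_le_of_norm_fderiv_le (hA2.differentiable (by norm_num))
      (fun x => (norm_fderiv_fderiv_eq _ x).trans_le (h2 x)) (a + p, b + q) (F + p, F + q))
  have k2 := ((fderiv ℝ Vs (a + p) - fderiv ℝ Vs (F + p)).le_opNorm 1).trans
    (mul_le_mul_of_nonneg_right (norm_sub_le_of_norm_fderiv_le (hB2.differentiable (by norm_num))
      (fun x => (norm_fderiv_fderiv_eq _ x).trans_le (hs x)) (a + p) (F + p)) (norm_nonneg _))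
  simp only [sub_apply, ← d1V_eq_fderiv hVd, Prod.mk_sub_mk, Prod.norm_mk,
    fderiv_apply_one_eq_deriv, Real.norm_eq_abs, add_sub_add_right_eq_sub, abs_one,
    mul_one] at k1 k2
  have k3 : M * max |a - F| |b - F| ≤ M * (|a - F| + |b - F|) :=
    mul_le_mul_of_nonneg_left (max_le_add_of_nonneg (abs_nonneg _) (abs_nonneg _)) hM0
  rw [abs_le] at k1 k2 ⊢
  constructor <;> linarith [k1.1, k1.2, k2.1, k2.2]

end SitePotential

/-- the single-element consistency estimate for the
predictor-corrector decomposition.  With `u = w + q` (so `u'_ℓ = w'_ℓ + q'_ℓ`),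
the duality pairing
`⟨δ𝓔ᵃ(u) − δ𝓔^{cb,disc}(w;F₀) − δ𝓔^Γ(q;F₀), v⟩` is written as the single
absolutely convergent series obtained by combining the three formal series
termwise. -/
theorem single_element_consistency (V : ℝ → ℝ → ℝ) (Vs : ℝ → ℝ)
    (hsmV : ContDiff ℝ 3 (Function.uncurry V)) (hsmVs : ContDiff ℝ 3 Vs)
    (hbdV : ∀ i : ℕ, i ≤ 3 → ∃ B : ℝ, ∀ p : ℝ × ℝ,
      ‖iteratedFDeriv ℝ i (Function.uncurry V) p‖ ≤ B)
    (hbdVs : ∀ i : ℕ, i ≤ 3 → ∃ B : ℝ, ∀ x : ℝ, ‖iteratedFDeriv ℝ i Vs x‖ ≤ B) :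
    ∃ C : ℝ, 0 < C ∧
      ∀ (w q v : ℕ → ℝ) (F0 : ℝ), memU w → memU q → memU v →
        |du v 0 *
            ((deriv Vs (du w 0 + du q 0)
                + d1V V (du w 0 + du q 0) (du w 1 + du q 1))
              - dW V F0
              - (deriv Vs (F0 + du q 0) + d1V V (F0 + du q 0) (F0 + du q 1)
                  - dW V F0))
          + ∑' ℓ : ℕ, du v (ℓ + 1) *
              ((d2V V (du w ℓ + du q ℓ) (du w (ℓ + 1) + du q (ℓ + 1))
                  + d1V V (du w (ℓ + 1) + du q (ℓ + 1))
                      (du w (ℓ + 2) + du q (ℓ + 2)))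
                - dW V (du w (ℓ + 1))
                - (d2V V (F0 + du q ℓ) (F0 + du q (ℓ + 1))
                    + d1V V (F0 + du q (ℓ + 1)) (F0 + du q (ℓ + 2))
                    - dW V F0))| ≤
          C * (Real.sqrt (∑' ℓ, (ddu w ℓ) ^ 4)
              + Real.sqrt (∑' ℓ : ℕ,
                  (du w (ℓ + 2) - 2 * du w (ℓ + 1) + du w ℓ) ^ 2)
              + Real.sqrt (∑' ℓ, (ddu q ℓ * ddu w ℓ) ^ 2)
              + |du w 0 - F0| + |du w 1 - F0|
              + Real.sqrt (∑' ℓ : ℕ,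
                  (|du q ℓ| + |du q (ℓ + 1)| + |du q (ℓ + 2)|) ^ 2
                    * (du w (ℓ + 1) - F0) ^ 2))
            * l2 (du v) := by
  obtain ⟨B₂, hB₂⟩ := hbdV 2 (by norm_num)
  obtain ⟨B₃, hB₃⟩ := hbdV 3 (by norm_num)
  obtain ⟨Bs, hBs⟩ := hbdVs 2 (by norm_num)
  obtain ⟨M, hM1, hM2, hM3, hMs⟩ : ∃ M : ℝ, 1 ≤ M ∧ B₂ ≤ M ∧ B₃ ≤ M ∧ Bs ≤ M :=
    ⟨max (max 1 B₂) (max B₃ Bs), by simp, by simp, by simp, by simp⟩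
  refine ⟨2 * M, by linarith, fun w q v F0 hw hq hv => ?_⟩
  have h2 := fun x => (hB₂ x).trans hM2
  have h3 := fun x => (hB₃ x).trans hM3
  have hs := fun x => (hBs x).trans hMs
  have hw1 := (summable_nat_add_iff 1).2 hw.2
  have hq1 := (summable_nat_add_iff 1).2 hq.2
  have hv1 := (summable_nat_add_iff 1).2 hv.2
  have hddw : Summable fun i => ddu w i ^ 2 := summable_sq_sub hw1 hw.2
  have hddq : Summable fun i => ddu q i ^ 2 := summable_sq_sub hq1 hq.2
  have hddw1 := (summable_nat_add_iff 1).2 hddw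
  have hw4 : Summable fun i => ddu w i ^ 4 := by
    simpa only [← pow_add] using summable_sq_mul_sq hddw hddw
  have hqw : Summable fun i => (ddu q i * ddu w i) ^ 2 := by
    simpa only [mul_pow] using summable_sq_mul_sq hddq hddw
  have hq2 := (summable_nat_add_iff 2).2 hq.2
  have hS : Summable fun i => (|du q i| + |du q (i + 1)| + |du q (i + 2)|) ^ 2 :=
    summable_sq_add (summable_sq_add (f := fun i => |du q i|) (g := fun i => |du q (i + 1)|)
      (by simpa using hq.2) (by simpa using hq1)) (g := fun i => |du q (i + 2)|)
      (by simpa using hq2)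
  have hSw : Summable fun i => ((|du q i| + |du q (i + 1)| + |du q (i + 2)|)
      * (du w (i + 1) - F0)) ^ 2 := by
    refine Summable.of_nonneg_of_le (fun _ => sq_nonneg _) (fun i => ?_)
      (hS.mul_right ((l2 (du w) + |F0|) ^ 2))
    rw [mul_pow]
    refine mul_le_mul_of_nonneg_left ?_ (sq_nonneg _)
    refine sq_le_sq' ?_ ?_ <;>
      linarith [(abs_le.1 ((abs_sub (du w (i + 1)) F0).trans
        (add_le_add_left (abs_le_l2 hw.2 (i + 1)) |F0|))).1,
        (abs_le.1 ((abs_sub (du w (i + 1)) F0).trans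
        (add_le_add_left (abs_le_l2 hw.2 (i + 1)) |F0|))).2]
  have h3w : Summable fun i => (du w (i + 2) - 2 * du w (i + 1) + du w i) ^ 2 :=
    (summable_sq_sub hddw1 hddw).congr fun i => by
      simp only [ddu]; ring
  have hsite := fun i => abs_site_error_le (by linarith) hsmV h2 h3 (du w i) (du w (i + 1))
    (du w (i + 2)) (du q i) (du q (i + 1)) (du q (i + 2)) F0
  have hint := abs_tsum_mul_le hv1 (f₁ := fun i => ddu w i ^ 2)
    (f₂ := fun i => ddu w (i + 1) ^ 2) (by simpa only [← pow_mul] using hw4)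
    (by simpa only [← pow_mul] using (summable_nat_add_iff 1).2 hw4) h3w hqw
    ((summable_nat_add_iff 1).2 hqw) hSw (by linarith) hsite
  have hbdry := abs_boundary_error_le (by linarith) hsmV h2 hsmVs hs (du w 0) (du w 1) (du q 0)
    (du q 1) F0
  have sh4 := sqrt_tsum_succ_le hw4 fun _ => by positivity
  have shqw := sqrt_tsum_succ_le hqw fun _ => sq_nonneg _
  have shv : √(∑' i, du v (i + 1) ^ 2) ≤ l2 (du v) :=
    sqrt_tsum_succ_le hv.2 fun _ => sq_nonneg _
  simp only [← pow_mul, mul_pow (_ + _ + _)] at hint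
  norm_num only at hint
  have hv0 := abs_le_l2 hv.2 0
  have hl0 : 0 ≤ l2 (du v) := Real.sqrt_nonneg _
  refine (abs_add_le _ _).trans ?_
  rw [abs_mul]
  refine (add_le_add (mul_le_mul hv0 hbdry (abs_nonneg _) hl0)
    (hint.trans (mul_le_mul_of_nonneg_left shv (by positivity)))).trans ?_
  rw [mul_comm (l2 (du v)), ← add_mul]
  refine mul_le_mul_of_nonneg_right ?_ hl0
  rw [← mul_add, mul_comm 2 M, mul_assoc]
  refine mul_le_mul_of_nonneg_left ?_ (by linarith)
  have := Real.sqrt_nonneg (∑' ℓ : ℕ, (du w (ℓ + 2) - 2 * du w (ℓ + 1) + du w ℓ) ^ 2)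
  have := abs_nonneg (du w 1 - F0)
  linarith
end
end
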